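/- Let g = (g¹, ..., g^p) be holomorphic functions on a domain U ⊆ ℂⁿ with |g|² = Σⱼ|gʲ|² > 0, and let q = min(n, p-1). Then for any collection of vectors β₁, ..., β_p ∈ ℂⁿ at a point of U: q · Σ_k β_k^ν β̄_k^μ ∂_ν∂_μ̄ log|g|² ≥ |g|² · |Σ_k β_k^ν ∂_ν(g^k |g|^{-2})|². -/

import Mathlib

open Complex

/-- The Wirtinger derivative `∂/∂z^ν` of `f` at `z`. -/
noncomputable def wderiv {n : ℕ} (ν : Fin n) (f : (Fin n → ℂ) → ℂ) (z : Fin n → ℂ) : ℂ :=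
  (1 / 2) * (fderiv ℝ f z (Pi.single ν 1) - Complex.I * fderiv ℝ f z (Pi.single ν Complex.I))

/-- The Wirtinger derivative `∂/∂z̄^μ` of `f` at `z`. -/
noncomputable def wderivBar {n : ℕ} (μ : Fin n) (f : (Fin n → ℂ) → ℂ) (z : Fin n → ℂ) : ℂ :=
  (1 / 2) * (fderiv ℝ f z (Pi.single μ 1) + Complex.I * fderiv ℝ f z (Pi.single μ Complex.I))

/-- The complex Hessian `∂_ν ∂_μ̄ f` at `z`. -/
noncomputable def cHess {n : ℕ} (ν μ : Fin n) (f : (Fin n → ℂ) → ℂ) (z : Fin n → ℂ) : ℂ :=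
  wderiv ν (fun w => wderivBar μ f w) z

open scoped Topology ComplexConjugate

/-- Directional derivatives of holomorphic functions of several variables are holomorphic. -/
lemma sk_dirDeriv_differentiableAt {n : ℕ} {U : Set (Fin n → ℂ)} (hU : IsOpen U)
    {f : (Fin n → ℂ) → ℂ} (hf : DifferentiableOn ℂ f U) {z : Fin n → ℂ} (hz : z ∈ U)
    (v : Fin n → ℂ) : DifferentiableAt ℂ (fun w => fderiv ℂ f w v) z := by
  have hdiff : ∀ w ∈ U, DifferentiableAt ℂ f w := fun w hw => hf.differentiableAt (hU.mem_nhds hw)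
  obtain ⟨ε, hε, hball⟩ : ∃ ε > 0, ∀ w ∈ Metric.ball z ε, w ∈ U ∧ ‖f w‖ ≤ ‖f z‖ + 1 := by
    have h1 : ∀ᶠ w in 𝓝 z, w ∈ U := hU.mem_nhds hz
    have h2 : ∀ᶠ w in 𝓝 z, ‖f w‖ < ‖f z‖ + 1 :=
      (hdiff z hz).continuousAt.norm.eventually_lt continuousAt_const (by simp)
    obtain ⟨ε, hε, h⟩ := Metric.eventually_nhds_iff_ball.1 (h1.and h2)
    exact ⟨ε, hε, fun w hw => ⟨(h w hw).1, (h w hw).2.le⟩⟩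
  set M := ‖f z‖ + 1 with hM
  have hM0 : 0 ≤ M := by positivity
  set R := ε / 4 with hR
  have hR0 : 0 < R := by positivity
  -- line restriction
  have line : ∀ (w u : Fin n → ℂ) (ζ : ℂ), w + ζ • u ∈ U →
      HasDerivAt (fun t : ℂ => f (w + t • u)) (fderiv ℂ f (w + ζ • u) u) ζ := by
    intro w u ζ h
    have h1 : HasDerivAt (fun t : ℂ => w + t • u) u ζ := by
      simpa using ((hasDerivAt_id ζ).smul_const u).const_add w
    exact (hdiff _ h).hasFDerivAt.comp_hasDerivAt ζ h1
  have near : ∀ x (u : Fin n → ℂ) (ζ : ℂ) (c : ℝ), x ∈ Metric.ball z c → ‖ζ‖ * ‖u‖ ≤ R →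
      x + ζ • u ∈ Metric.ball z (c + R) := by
    intro x u ζ c hx h
    rw [mem_ball_iff_norm] at hx ⊢
    calc ‖x + ζ • u - z‖ = ‖(x - z) + ζ • u‖ := by congr 1; abel
      _ ≤ ‖x - z‖ + ‖ζ • u‖ := norm_add_le _ _
      _ < c + R := by rw [norm_smul]; linarith
  have fbound : ∀ x ∈ Metric.ball z (2 * R), ‖fderiv ℂ f x‖ ≤ M / R := by
    intro x hx
    refine ContinuousLinearMap.opNorm_le_bound _ (by positivity) fun u => ?_
    by_cases hu : u = 0
    · simp [hu]
    have hu' : 0 < ‖u‖ := norm_pos_iff.2 hu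
    have hin : ∀ ζ : ℂ, ‖ζ‖ ≤ R / ‖u‖ → x + ζ • u ∈ Metric.ball z ε := by
      intro ζ hζ
      have := near x u ζ _ hx ((le_div_iff₀ hu').1 hζ)
      exact Metric.ball_subset_ball (by rw [hR]; linarith) this
    have hx' : x ∈ U := (hball x (by simpa using hin 0 (by simp; positivity))).1
    have hd : deriv (fun t : ℂ => f (x + t • u)) 0 = fderiv ℂ f x u := by
      have := (line x u 0 (by simpa using hx')).deriv
      simpa using this
    rw [← hd]
    have := Complex.norm_deriv_le_of_forall_mem_sphere_norm_le (c := 0) (R := R / ‖u‖) (C := M)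
      (f := fun t : ℂ => f (x + t • u)) (by positivity) ?_ ?_
    · calc _ ≤ M / (R / ‖u‖) := this
        _ = M / R * ‖u‖ := by field_simp
    · apply DifferentiableOn.diffContOnCl
      intro t ht
      have ht' : ‖t‖ ≤ R / ‖u‖ := by
        have := Metric.closure_ball_subset_closedBall ht
        simpa using this
      exact (line x u t (hball _ (hin t ht')).1).differentiableAt.differentiableWithinAt
    · intro t ht
      exact (hball _ (hin t (by simp at ht; exact ht.le))).2
  set ρ := R / (‖v‖ + 1) with hρ
  have hρ0 : 0 < ρ := by positivity
  have hρv : ρ * ‖v‖ ≤ R := by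
    rw [hρ, div_mul_eq_mul_div, div_le_iff₀ (by positivity)]
    nlinarith [norm_nonneg v]
  have hnorm : ∀ θ : ℝ, ‖circleMap 0 ρ θ‖ = ρ := fun θ => by
    simp [circleMap, abs_of_pos hρ0]
  have hinU : ∀ x ∈ Metric.ball z R, ∀ ζ : ℂ, ‖ζ‖ ≤ ρ → x + ζ • v ∈ Metric.ball z (2 * R) := by
    intro x hx ζ hζ
    have := near x v ζ R hx
      ((mul_le_mul_of_nonneg_right hζ (norm_nonneg v)).trans hρv)
    rwa [← two_mul] at this
  have h2R : Metric.ball z (2 * R) ⊆ U := fun y hy =>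
    (hball y (Metric.ball_subset_ball (by rw [hR]; linarith) hy)).1
  -- the kernel
  let κ : ℝ → ℂ := fun θ => deriv (circleMap 0 ρ) θ * (circleMap 0 ρ θ ^ 2)⁻¹
  have hκ : Continuous κ := by
    have hc : Continuous (circleMap 0 ρ) := continuous_circleMap 0 ρ
    refine Continuous.mul ?_ (Continuous.inv₀ (hc.pow 2) fun θ => ?_)
    · have : deriv (circleMap 0 ρ) = fun θ => circleMap 0 ρ θ * Complex.I := by
        funext θ; simp [deriv_circleMap]
      rw [this]; fun_prop
    · have : circleMap 0 ρ θ ≠ 0 := norm_pos_iff.1 (by rw [hnorm]; exact hρ0)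
      positivity
  have formula : ∀ x ∈ Metric.ball z R, fderiv ℂ f x v =
      (2 * Real.pi * Complex.I : ℂ)⁻¹ *
        ∫ θ in (0 : ℝ)..2 * Real.pi, κ θ * f (x + circleMap 0 ρ θ • v) := by
    intro x hx
    have hd : deriv (fun t : ℂ => f (x + t • v)) 0 = fderiv ℂ f x v := by
      have := (line x v 0 (h2R (hinU x hx 0 (by simpa using hρ0.le)))).deriv
      simpa using this
    have h := DiffContOnCl.deriv_eq_smul_circleIntegral (c := 0) (R := ρ)
      (f := fun t : ℂ => f (x + t • v)) hρ0 ?_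
    · have h2 : (∮ (t : ℂ) in C(0, ρ), (1 / (t - 0) ^ 2) • f (x + t • v)) =
          ∫ θ in (0 : ℝ)..2 * Real.pi, κ θ * f (x + circleMap 0 ρ θ • v) := by
        rw [circleIntegral]
        simp only [smul_eq_mul, sub_zero, κ, mul_assoc, one_div]
      rw [← h2, h, ← hd, smul_eq_mul, inv_mul_cancel_left₀ Complex.two_pi_I_ne_zero]
    · apply DifferentiableOn.diffContOnCl
      intro t ht
      have ht' : ‖t‖ ≤ ρ := by
        have := Metric.closure_ball_subset_closedBall ht
        simpa using this
      exact (line x v t (h2R (hinU x hx t ht'))).differentiableAt.differentiableWithinAt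
  have hcont : ∀ x ∈ Metric.ball z R,
      Continuous fun θ => κ θ * f (x + circleMap 0 ρ θ • v) := by
    intro x hx
    refine hκ.mul ?_
    rw [continuous_iff_continuousAt]
    intro θ
    have h1 : ContinuousAt f (x + circleMap 0 ρ θ • v) :=
      (hdiff _ (h2R (hinU x hx _ (hnorm θ).le))).continuousAt
    have h2 : ContinuousAt (fun θ => x + circleMap 0 ρ θ • v) θ := by
      have hc : Continuous (circleMap 0 ρ) := continuous_circleMap 0 ρ
      fun_prop
    exact ContinuousAt.comp (f := fun θ => x + circleMap 0 ρ θ • v) h1 h2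
  have hz' : z ∈ Metric.ball z R := Metric.mem_ball_self hR0
  have key := intervalIntegral.hasFDerivAt_integral_of_dominated_of_fderiv_le (𝕜 := ℂ)
    (μ := MeasureTheory.volume) (a := 0) (b := 2 * Real.pi) (x₀ := z)
    (F := fun x θ => κ θ * f (x + circleMap 0 ρ θ • v))
    (F' := fun x θ => κ θ • fderiv ℂ f (x + circleMap 0 ρ θ • v))
    (bound := fun θ => ‖κ θ‖ * (M / R)) (s := Metric.ball z R)
    (Metric.ball_mem_nhds z hR0) ?_ ?_ ?_ ?_ ?_ ?_
  · have hd := (key.const_mul ((2 * Real.pi * Complex.I : ℂ)⁻¹)).differentiableAt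
    refine hd.congr_of_eventuallyEq ?_
    filter_upwards [Metric.ball_mem_nhds z hR0] with x hx
    exact formula x hx
  · filter_upwards [Metric.ball_mem_nhds z hR0] with x hx
    exact (hcont x hx).aestronglyMeasurable
  · exact (hcont z hz').intervalIntegrable _ _
  · have hm : Measurable fun θ : ℝ => fderiv ℂ f (z + circleMap 0 ρ θ • v) := by
      have hc : Continuous (circleMap 0 ρ) := continuous_circleMap 0 ρ
      have : Continuous fun θ => z + circleMap 0 ρ θ • v := by fun_prop
      exact (measurable_fderiv ℂ f).comp this.measurable
    exact (hκ.measurable.smul hm).aestronglyMeasurable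
  · refine Filter.Eventually.of_forall fun θ _ x hx => ?_
    rw [norm_smul]
    exact mul_le_mul_of_nonneg_left (fbound _ (hinU x hx _ (hnorm θ).le)) (norm_nonneg _)
  · exact (hκ.norm.mul continuous_const).intervalIntegrable _ _
  · refine Filter.Eventually.of_forall fun θ _ x hx => ?_
    have h := (hdiff _ (h2R (hinU x hx _ (hnorm θ).le))).hasFDerivAt
    have h2 := ((hasFDerivAt_comp_add_right (circleMap 0 ρ θ • v)).2 h).const_mul (κ θ)
    exact h2

/-- `f` has holomorphic differential `A` and antiholomorphic differential `conj B` at `z`. -/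
def SkHas {n : ℕ} (f : (Fin n → ℂ) → ℂ) (A B : (Fin n → ℂ) →L[ℂ] ℂ) (z : Fin n → ℂ) : Prop :=
  HasFDerivAt (𝕜 := ℝ) f (A.restrictScalars ℝ +
    (Complex.conjCLE : ℂ →L[ℝ] ℂ).comp (B.restrictScalars ℝ)) z

lemma SkHas.wderiv_eq {n : ℕ} {f : (Fin n → ℂ) → ℂ} {A B : (Fin n → ℂ) →L[ℂ] ℂ}
    {z : Fin n → ℂ} (h : SkHas f A B z) (ν : Fin n) : wderiv ν f z = A (Pi.single ν 1) := by
  have e : (Pi.single ν Complex.I : Fin n → ℂ) = Complex.I • Pi.single ν 1 := by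
    rw [← Pi.single_smul]; simp
  unfold wderiv
  rw [HasFDerivAt.fderiv h, e]
  simp
  linear_combination (-1/2 * (A (Pi.single ν 1) - conj (B (Pi.single ν 1)))) * Complex.I_sq

lemma SkHas.wderivBar_eq {n : ℕ} {f : (Fin n → ℂ) → ℂ} {A B : (Fin n → ℂ) →L[ℂ] ℂ}
    {z : Fin n → ℂ} (h : SkHas f A B z) (ν : Fin n) :
    wderivBar ν f z = conj (B (Pi.single ν 1)) := by
  have e : (Pi.single ν Complex.I : Fin n → ℂ) = Complex.I • Pi.single ν 1 := by
    rw [← Pi.single_smul]; simp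
  unfold wderivBar
  rw [HasFDerivAt.fderiv h, e]
  simp
  linear_combination (1/2 * (A (Pi.single ν 1) - conj (B (Pi.single ν 1)))) * Complex.I_sq

lemma SkHas.of_holo {n : ℕ} {f : (Fin n → ℂ) → ℂ} {z : Fin n → ℂ}
    (h : DifferentiableAt ℂ f z) : SkHas f (fderiv ℂ f z) 0 z := by
  have := h.hasFDerivAt.restrictScalars ℝ
  refine HasFDerivAt.congr_fderiv this ?_
  ext u; simp

lemma SkHas.conj {n : ℕ} {f : (Fin n → ℂ) → ℂ} {A B : (Fin n → ℂ) →L[ℂ] ℂ}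
    {z : Fin n → ℂ} (h : SkHas f A B z) : SkHas (fun w => conj (f w)) B A z := by
  have := (Complex.conjCLE : ℂ →L[ℝ] ℂ).hasFDerivAt.comp z h
  refine HasFDerivAt.congr_fderiv this ?_
  ext u; simp [add_comm]

lemma SkHas.mul {n : ℕ} {f f' : (Fin n → ℂ) → ℂ} {A B A' B' : (Fin n → ℂ) →L[ℂ] ℂ}
    {z : Fin n → ℂ} (h : SkHas f A B z) (h' : SkHas f' A' B' z) :
    SkHas (fun w => f w * f' w) (f z • A' + f' z • A)
      ((starRingEnd ℂ (f z)) • B' + (starRingEnd ℂ (f' z)) • B) z := by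
  have := HasFDerivAt.mul (𝕜 := ℝ) h h'
  refine HasFDerivAt.congr_fderiv this ?_
  ext u; simp; ring

lemma SkHas.sum {n : ℕ} {ι : Type*} [Fintype ι] {f : ι → (Fin n → ℂ) → ℂ}
    {A B : ι → (Fin n → ℂ) →L[ℂ] ℂ}
    {z : Fin n → ℂ} (h : ∀ i, SkHas (f i) (A i) (B i) z) :
    SkHas (fun w => ∑ i, f i w) (∑ i, A i) (∑ i, B i) z := by
  have := HasFDerivAt.fun_sum (𝕜 := ℝ) (u := Finset.univ) fun i _ => h i
  refine HasFDerivAt.congr_fderiv this ?_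
  ext u; simp [Finset.sum_add_distrib]

lemma SkHas.comp {n : ℕ} {f : (Fin n → ℂ) → ℂ} {A B : (Fin n → ℂ) →L[ℂ] ℂ}
    {z : Fin n → ℂ} (h : SkHas f A B z) {φ : ℂ → ℂ} {c : ℂ} (hφ : HasDerivAt φ c (f z)) :
    SkHas (fun w => φ (f w)) (c • A) ((starRingEnd ℂ c) • B) z := by
  have := (hφ.hasFDerivAt.restrictScalars ℝ).comp z h
  refine HasFDerivAt.congr_fderiv this ?_
  ext u; simp; ring

/-- Trace estimate for a family of vectors spanning a space of dimension at most `q`. -/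
lemma sk_trace {p q : ℕ} (m : Fin p → EuclideanSpace ℂ (Fin p))
    (hq : Module.finrank ℂ (Submodule.span ℂ (Set.range m)) ≤ q) :
    ‖∑ k, m k k‖ ^ 2 ≤ q * ∑ k, ‖m k‖ ^ 2 := by
  set W := Submodule.span ℂ (Set.range m) with hW
  let e := stdOrthonormalBasis ℂ W
  have hm : ∀ k, m k ∈ W := fun k => Submodule.subset_span ⟨k, rfl⟩
  let c : Fin p → Fin (Module.finrank ℂ W) → ℂ := fun k i => e.repr ⟨m k, hm k⟩ i
  have h1 : ∀ k, m k k = ∑ i, c k i * (e i : EuclideanSpace ℂ (Fin p)) k := by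
    intro k
    have := congrArg (fun x : W => (x : EuclideanSpace ℂ (Fin p)) k) (e.sum_repr ⟨m k, hm k⟩)
    simp at this
    rw [← this]
  have h2 : ∀ k, ‖m k‖ ^ 2 = ∑ i, ‖c k i‖ ^ 2 := by
    intro k
    have : ‖m k‖ = ‖e.repr ⟨m k, hm k⟩‖ := by rw [LinearIsometryEquiv.norm_map]; rfl
    rw [this, EuclideanSpace.norm_sq_eq]
  have h3 : ∑ k, ∑ i, ‖(e i : EuclideanSpace ℂ (Fin p)) k‖ ^ 2 ≤ q := by
    rw [Finset.sum_comm]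
    have : ∀ i, ∑ k, ‖(e i : EuclideanSpace ℂ (Fin p)) k‖ ^ 2 = 1 := by
      intro i
      rw [← EuclideanSpace.norm_sq_eq]
      have : ‖(e i : EuclideanSpace ℂ (Fin p))‖ = 1 := e.orthonormal.1 i
      rw [this]; simp
    simp only [this]
    simpa using hq
  have h4 : ‖∑ k, m k k‖ ≤ ∑ x : Fin p × Fin (Module.finrank ℂ W),
      ‖c x.1 x.2‖ * ‖(e x.2 : EuclideanSpace ℂ (Fin p)) x.1‖ := by
    simp only [h1]
    rw [← Fintype.sum_prod_type' (f := fun k i => c k i * (e i : EuclideanSpace ℂ (Fin p)) k)]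
    refine (norm_sum_le _ _).trans (Finset.sum_le_sum fun x _ => ?_)
    rw [norm_mul]
  calc ‖∑ k, m k k‖ ^ 2 ≤ (∑ x : Fin p × Fin (Module.finrank ℂ W),
      ‖c x.1 x.2‖ * ‖(e x.2 : EuclideanSpace ℂ (Fin p)) x.1‖) ^ 2 := by gcongr
    _ ≤ (∑ x : Fin p × Fin (Module.finrank ℂ W), ‖c x.1 x.2‖ ^ 2) *
        ∑ x : Fin p × Fin (Module.finrank ℂ W),
          ‖(e x.2 : EuclideanSpace ℂ (Fin p)) x.1‖ ^ 2 := Finset.sum_mul_sq_le_sq_mul_sq _ _ _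
    _ = (∑ k, ‖m k‖ ^ 2) * ∑ k, ∑ i, ‖(e i : EuclideanSpace ℂ (Fin p)) k‖ ^ 2 := by
        simp only [h2, Fintype.sum_prod_type]
    _ ≤ (∑ k, ‖m k‖ ^ 2) * q := by gcongr
    _ = _ := mul_comm _ _

/-- The algebraic core. `a j ν` are the derivatives, `γ j` the values. -/
lemma sk_alg {n p : ℕ} (γ : Fin p → ℂ) (a : Fin p → Fin n → ℂ) (β : Fin p → Fin n → ℂ)
    (G : ℝ) (hG : G = ∑ j, ‖γ j‖ ^ 2) (hG0 : 0 < G) :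
    ((min n (p - 1) : ℕ) : ℝ) * (∑ k, ∑ ν, ∑ μ, β k ν * conj (β k μ) *
        ((∑ j, conj (a j μ) * a j ν) * (G : ℂ)⁻¹
          - (∑ j, γ j * conj (a j μ)) * (∑ j, conj (γ j) * a j ν) * ((G : ℂ) ^ 2)⁻¹)).re
      ≥ G * ‖∑ k, ∑ ν, β k ν * (a k ν * (G : ℂ)⁻¹
          - γ k * (∑ j, conj (γ j) * a j ν) * ((G : ℂ) ^ 2)⁻¹)‖ ^ 2 := by
  have hGc : (G : ℂ) ≠ 0 := by exact_mod_cast hG0.ne'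
  have hGs : (G : ℂ) = ∑ j, γ j * conj (γ j) := by
    rw [hG]; push_cast
    exact Finset.sum_congr rfl fun j _ => by rw [Complex.mul_conj']
  let c : Fin n → EuclideanSpace ℂ (Fin p) := fun ν => WithLp.toLp 2 fun j =>
    a j ν - γ j * (∑ i, conj (γ i) * a i ν) * (G : ℂ)⁻¹
  let m : Fin p → EuclideanSpace ℂ (Fin p) := fun k => ∑ ν, β k ν • c ν
  have mval : ∀ k j, m k j = ∑ ν, β k ν * (a j ν - γ j * (∑ i, conj (γ i) * a i ν) * (G : ℂ)⁻¹) := by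
    intro k j; simp [m, c]
  have corth : ∀ ν, ∑ j, conj (γ j) * (a j ν - γ j * (∑ i, conj (γ i) * a i ν) * (G : ℂ)⁻¹) = 0 := by
    intro ν
    have : ∀ j, conj (γ j) * (a j ν - γ j * (∑ i, conj (γ i) * a i ν) * (G : ℂ)⁻¹) =
      conj (γ j) * a j ν - (γ j * conj (γ j)) * ((∑ i, conj (γ i) * a i ν) * (G : ℂ)⁻¹) :=
      fun j => by ring
    simp only [this, Finset.sum_sub_distrib, ← Finset.sum_mul, ← hGs]
    field_simp
    ring
  have r1 : Module.finrank ℂ (Submodule.span ℂ (Set.range m)) ≤ n := by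
    have hle : Submodule.span ℂ (Set.range m) ≤ Submodule.span ℂ (Set.range c) := by
      rw [Submodule.span_le]
      rintro _ ⟨k, rfl⟩
      exact Submodule.sum_mem _ fun ν _ => Submodule.smul_mem _ _ (Submodule.subset_span ⟨ν, rfl⟩)
    refine (Submodule.finrank_mono hle).trans ?_
    have h := finrank_range_le_card (R := ℂ) c
    rw [Fintype.card_fin] at h
    exact h
  have r2 : Module.finrank ℂ (Submodule.span ℂ (Set.range m)) ≤ p - 1 := by
    let γ' : EuclideanSpace ℂ (Fin p) := WithLp.toLp 2 γ
    have hγ : γ' ≠ 0 := by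
      intro h
      have : ∀ j, γ j = 0 := fun j => by
        have := congrArg (fun x : EuclideanSpace ℂ (Fin p) => x j) h
        simpa [γ'] using this
      simp [this] at hG
      exact hG0.ne' hG
    have hle : Submodule.span ℂ (Set.range m) ≤ (Submodule.span ℂ {γ'})ᗮ := by
      rw [Submodule.span_le]
      rintro _ ⟨k, rfl⟩
      refine Submodule.sum_mem _ fun ν _ => Submodule.smul_mem _ _ ?_
      rw [Submodule.mem_orthogonal_singleton_iff_inner_right, PiLp.inner_apply]
      rw [← corth ν]
      refine Finset.sum_congr rfl fun j _ => ?_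
      simp [γ', c, mul_comm]
    refine (Submodule.finrank_mono hle).trans ?_
    have h1 := Submodule.finrank_add_finrank_orthogonal (Submodule.span ℂ {γ'})
    rw [finrank_span_singleton hγ, finrank_euclideanSpace_fin] at h1
    omega
  have T := sk_trace m (q := min n (p - 1)) (le_min r1 r2)
  have e1 : ∑ k, ∑ ν, β k ν * (a k ν * (G : ℂ)⁻¹
          - γ k * (∑ j, conj (γ j) * a j ν) * ((G : ℂ) ^ 2)⁻¹) = (∑ k, m k k) * (G : ℂ)⁻¹ := by
    simp only [mval, Finset.sum_mul]
    refine Finset.sum_congr rfl fun k _ => Finset.sum_congr rfl fun ν _ => ?_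
    field_simp
  have hc : ∀ ν μ, (∑ j, conj (a j μ) * a j ν) * (G : ℂ)⁻¹
          - (∑ j, γ j * conj (a j μ)) * (∑ j, conj (γ j) * a j ν) * ((G : ℂ) ^ 2)⁻¹
        = (∑ j, c ν j * conj (c μ j)) * (G : ℂ)⁻¹ := by
    intro ν μ
    have hs : conj (∑ i, conj (γ i) * a i μ) = ∑ j, γ j * conj (a j μ) := by simp
    have : ∀ j, c ν j * conj (c μ j) = conj (a j μ) * a j ν
        - (γ j * conj (a j μ)) * ((∑ i, conj (γ i) * a i ν) * (G : ℂ)⁻¹)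
        - (conj (γ j) * (a j ν - γ j * (∑ i, conj (γ i) * a i ν) * (G : ℂ)⁻¹)) *
          ((∑ j, γ j * conj (a j μ)) * (G : ℂ)⁻¹) := by
      intro j
      simp only [c, map_sub, map_mul, map_inv₀, Complex.conj_ofReal, hs]
      ring
    simp only [this, Finset.sum_sub_distrib, ← Finset.sum_mul]
    rw [corth ν]
    field_simp
    ring
  have e2 : ∑ k, ∑ ν, ∑ μ, β k ν * conj (β k μ) *
        ((∑ j, conj (a j μ) * a j ν) * (G : ℂ)⁻¹
          - (∑ j, γ j * conj (a j μ)) * (∑ j, conj (γ j) * a j ν) * ((G : ℂ) ^ 2)⁻¹)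
      = (((∑ k, ‖m k‖ ^ 2) * G⁻¹ : ℝ) : ℂ) := by
    push_cast
    rw [Finset.sum_mul]
    refine Finset.sum_congr rfl fun k _ => ?_
    have hmk : ((‖m k‖ : ℂ)) ^ 2 = ∑ j, m k j * conj (m k j) := by
      rw [← Complex.ofReal_pow, EuclideanSpace.norm_sq_eq]; push_cast
      exact Finset.sum_congr rfl fun j _ => by rw [Complex.mul_conj']
    have hmv : ∀ j, m k j = ∑ ν, β k ν * c ν j := fun j => by simp [m]
    simp only [hc]
    rw [hmk]
    simp only [hmv, map_sum, map_mul, Finset.sum_mul_sum]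
    have swap : ∀ F : Fin p → Fin n → Fin n → ℂ,
        ∑ j, ∑ ν, ∑ μ, F j ν μ = ∑ ν, ∑ μ, ∑ j, F j ν μ := by
      intro F
      rw [Finset.sum_comm]
      exact Finset.sum_congr rfl fun ν _ => Finset.sum_comm
    rw [swap, Finset.sum_mul]
    refine Finset.sum_congr rfl fun ν _ => ?_
    rw [Finset.sum_mul]
    refine Finset.sum_congr rfl fun μ _ => ?_
    rw [← mul_assoc, Finset.mul_sum]
    congr 1
    exact Finset.sum_congr rfl fun j _ => by ring
  rw [e1, e2, Complex.ofReal_re, norm_mul, norm_inv, Complex.norm_real, Real.norm_of_nonneg hG0.le]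
  have : G * (‖∑ k, m k k‖ * G⁻¹) ^ 2 = ‖∑ k, m k k‖ ^ 2 * G⁻¹ := by field_simp
  rw [this, ge_iff_le, ← mul_assoc]
  exact mul_le_mul_of_nonneg_right T (by positivity)

theorem skoda_inequality
    {n p : ℕ} (hp : 0 < p) (U : Set (Fin n → ℂ)) (hU : IsOpen U)
    (hUconn : IsConnected U)
    (g : Fin p → (Fin n → ℂ) → ℂ)
    (hg : ∀ j, DifferentiableOn ℂ (g j) U)
    (hgpos : ∀ w ∈ U, 0 < ∑ j, ‖g j w‖ ^ 2)
    (q : ℕ) (hq : q = min n (p - 1)) :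
    ∀ z ∈ U, ∀ β : Fin p → Fin n → ℂ,
      (q : ℝ) * (∑ k, ∑ ν, ∑ μ, β k ν * (starRingEnd ℂ) (β k μ)
            * cHess ν μ (fun w => ((Real.log (∑ j, ‖g j w‖ ^ 2) : ℝ) : ℂ)) z).re
        ≥ (∑ j, ‖g j z‖ ^ 2)
          * ‖∑ k, ∑ ν, β k ν
              * wderiv ν (fun w => g k w / ((∑ j, ‖g j w‖ ^ 2 : ℝ) : ℂ)) z‖ ^ 2 := by
  intro z hz β
  have hd : ∀ j, ∀ w ∈ U, DifferentiableAt ℂ (g j) w :=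
    fun j w hw => (hg j).differentiableAt (hU.mem_nhds hw)
  have hGs : ∀ w, ((∑ j, ‖g j w‖ ^ 2 : ℝ) : ℂ) = ∑ j, g j w * conj (g j w) := by
    intro w; push_cast
    exact Finset.sum_congr rfl fun j _ => by rw [Complex.mul_conj']
  have hG : ∀ w ∈ U, SkHas (fun w => ((∑ j, ‖g j w‖ ^ 2 : ℝ) : ℂ))
      (∑ j, conj (g j w) • fderiv ℂ (g j) w) (∑ j, conj (g j w) • fderiv ℂ (g j) w) w := by
    intro w hw
    simp only [hGs]
    have := SkHas.sum fun j => (SkHas.of_holo (hd j w hw)).mul (SkHas.of_holo (hd j w hw)).conj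
    exact HasFDerivAt.congr_fderiv this (by ext u; simp)
  have hne : ∀ w ∈ U, ((∑ j, ‖g j w‖ ^ 2 : ℝ) : ℂ) ≠ 0 := fun w hw => by
    exact_mod_cast (hgpos w hw).ne'
  have hinv : SkHas (fun w => (((∑ j, ‖g j w‖ ^ 2 : ℝ) : ℂ))⁻¹) _ _ z :=
    (hG z hz).comp (φ := fun x => x⁻¹) (hasDerivAt_inv (hne z hz))
  -- the right-hand side
  have hR : ∀ k ν, wderiv ν (fun w => g k w / ((∑ j, ‖g j w‖ ^ 2 : ℝ) : ℂ)) z =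
      fderiv ℂ (g k) z (Pi.single ν 1) * (((∑ j, ‖g j z‖ ^ 2 : ℝ) : ℂ))⁻¹
        - g k z * (∑ j, conj (g j z) * fderiv ℂ (g j) z (Pi.single ν 1)) *
          ((((∑ j, ‖g j z‖ ^ 2 : ℝ) : ℂ)) ^ 2)⁻¹ := by
    intro k ν
    simp only [div_eq_mul_inv]
    rw [((SkHas.of_holo (hd k z hz)).mul hinv).wderiv_eq ν]
    simp only [_root_.add_apply, _root_.smul_apply,
      _root_.sum_apply, smul_eq_mul]
    ring
  -- first derivative of the logarithm
  have hL : ∀ μ, ∀ w ∈ U, wderivBar μ (fun w => ((Real.log (∑ j, ‖g j w‖ ^ 2) : ℝ) : ℂ)) w =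
      (∑ j, g j w * conj (fderiv ℂ (g j) w (Pi.single μ 1))) *
        (((∑ j, ‖g j w‖ ^ 2 : ℝ) : ℂ))⁻¹ := by
    intro μ w hw
    have hlog : (fun w => ((Real.log (∑ j, ‖g j w‖ ^ 2) : ℝ) : ℂ)) =
        fun w => Complex.log ((∑ j, ‖g j w‖ ^ 2 : ℝ) : ℂ) := by
      funext w
      exact Complex.ofReal_log (Finset.sum_nonneg fun j _ => by positivity)
    rw [hlog, ((hG w hw).comp (φ := Complex.log)
      (Complex.hasDerivAt_log (Complex.ofReal_mem_slitPlane.2 (hgpos w hw)))).wderivBar_eq μ]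
    simp only [_root_.smul_apply,
      _root_.sum_apply, smul_eq_mul, map_mul, map_sum, Complex.conj_conj]
    ring
  have hH : ∀ ν μ, cHess ν μ (fun w => ((Real.log (∑ j, ‖g j w‖ ^ 2) : ℝ) : ℂ)) z =
      (∑ j, conj (fderiv ℂ (g j) z (Pi.single μ 1)) * fderiv ℂ (g j) z (Pi.single ν 1)) *
          (((∑ j, ‖g j z‖ ^ 2 : ℝ) : ℂ))⁻¹
        - (∑ j, g j z * conj (fderiv ℂ (g j) z (Pi.single μ 1))) *
          (∑ j, conj (g j z) * fderiv ℂ (g j) z (Pi.single ν 1)) *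
          ((((∑ j, ‖g j z‖ ^ 2 : ℝ) : ℂ)) ^ 2)⁻¹ := by
    intro ν μ
    have hev : (fun w => wderivBar μ (fun w => ((Real.log (∑ j, ‖g j w‖ ^ 2) : ℝ) : ℂ)) w)
        =ᶠ[𝓝 z] fun w => (∑ j, g j w * conj (fderiv ℂ (g j) w (Pi.single μ 1))) *
        (((∑ j, ‖g j w‖ ^ 2 : ℝ) : ℂ))⁻¹ := by
      filter_upwards [hU.mem_nhds hz] with w hw using hL μ w hw
    have hcong : cHess ν μ (fun w => ((Real.log (∑ j, ‖g j w‖ ^ 2) : ℝ) : ℂ)) z =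
        wderiv ν (fun w => (∑ j, g j w * conj (fderiv ℂ (g j) w (Pi.single μ 1))) *
        (((∑ j, ‖g j w‖ ^ 2 : ℝ) : ℂ))⁻¹) z := by
      unfold cHess wderiv
      rw [hev.fderiv_eq]
    have hS := SkHas.sum fun j => (SkHas.of_holo (hd j z hz)).mul
      (SkHas.of_holo (sk_dirDeriv_differentiableAt hU (hg j) hz (Pi.single μ 1))).conj
    rw [hcong, (hS.mul hinv).wderiv_eq ν]
    simp only [_root_.add_apply, _root_.smul_apply,
      _root_.sum_apply, smul_eq_mul, _root_.zero_apply, mul_zero,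
      zero_add]
    ring
  simp only [hR, hH, hq]
  exact sk_alg (fun j => g j z) (fun j ν => fderiv ℂ (g j) z (Pi.single ν 1)) β _ rfl (hgpos z hz)
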